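/- arXiv:2505.17938 — 8 statements merged into one kernel-verified Lean document; each statement's English description precedes it below -/
import Mathlib

section
/- For every π ∈ Π, the constrained Gibbs probability q_λ(π) converges, as λ → 0⁺, to q*(π), where q*(π) = 1/|Π*| if π ∈ Π* and q*(π) = 0 otherwise. -/
open Finset Filter

/-- For every π, the constrained Gibbs probability q_λ(π) converges, as λ → 0⁺,
to q*(π) = 1/|Π*| if π ∈ Π* and 0 otherwise. -/
theorem gibbs_tendsto_optimal_uniform
    {α : Type*} [Fintype α] [DecidableEq α] [Nonempty α] (f : α → ℝ)
    (C : Finset α) (hC : C.Nonempty)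
    (fstar : ℝ) (hfstar : fstar = C.inf' hC f)
    (Pstar : Finset α) (hPstar : Pstar = C.filter fun π => f π = fstar)
    (Z : ℝ → ℝ) (hZ : ∀ lam : ℝ, Z lam = ∑ π ∈ C, Real.exp (-(f π - fstar) / lam))
    (q : ℝ → α → ℝ)
    (hq : ∀ (lam : ℝ) (π : α),
      q lam π = if π ∈ C then Real.exp (-(f π - fstar) / lam) / Z lam else 0)
    (π : α) :
    Tendsto (fun lam => q lam π) (nhdsWithin 0 (Set.Ioi 0))
      (nhds (if π ∈ Pstar then 1 / (Pstar.card : ℝ) else 0)) := by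
  have key : ∀ p ∈ C, Tendsto (fun lam => Real.exp (-(f p - fstar) / lam))
      (nhdsWithin 0 (Set.Ioi 0)) (nhds (if f p = fstar then (1 : ℝ) else 0)) := by
    intro p hp
    by_cases h : f p = fstar
    · simp [h]
    · rw [if_neg h]
      have hle : fstar ≤ f p := hfstar ▸ Finset.inf'_le f hp
      have hlt : -(f p - fstar) < 0 := by
        have := lt_of_le_of_ne hle (Ne.symm h)
        linarith
      have h1 : Tendsto (fun lam : ℝ => -(f p - fstar) / lam)
          (nhdsWithin 0 (Set.Ioi 0)) atBot := by
        simp only [div_eq_mul_inv]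
        exact tendsto_inv_nhdsGT_zero.const_mul_atTop_of_neg hlt
      exact Real.tendsto_exp_atBot.comp h1
  have hZt : Tendsto Z (nhdsWithin 0 (Set.Ioi 0)) (nhds (Pstar.card : ℝ)) := by
    have h := tendsto_finsetSum C key
    rw [Finset.sum_boole, ← hPstar] at h
    exact h.congr fun lam => (hZ lam).symm
  have hne : (Pstar.card : ℝ) ≠ 0 := by
    obtain ⟨p, hp, h⟩ := Finset.exists_mem_eq_inf' hC f
    have : p ∈ Pstar := by
      rw [hPstar, Finset.mem_filter]
      exact ⟨hp, by rw [hfstar, h]⟩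
    exact_mod_cast (Finset.card_pos.mpr ⟨p, this⟩).ne'
  by_cases hπ : π ∈ C
  · have h := (key π hπ).div hZt hne
    simp only [hq, if_pos hπ]
    have hmem : π ∈ Pstar ↔ f π = fstar := by simp [hPstar, hπ]
    simp only [hmem]
    have e : (if f π = fstar then 1 / (Pstar.card : ℝ) else 0)
        = (if f π = fstar then (1 : ℝ) else 0) / (Pstar.card : ℝ) := by
      split_ifs <;> simp
    rw [e]
    exact h
  · have : π ∉ Pstar := by simp [hPstar, hπ]
    simp [hq, hπ, this]
end

section
/- Numerator bound: if C \ Π* is nonempty and 0 < λ ≤ Δ, then Σ_{π ∈ C \ Π*} exp(−(f(π) − f*)/λ)·(f(π) − f*) ≤ |C|·Δ·exp(−Δ/λ). -/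
open Finset

/-- Numerator bound: if C \ Π* is nonempty and 0 < λ ≤ Δ, then
Σ_{π ∈ C\Π*} exp(−(f(π)−f*)/λ)(f(π)−f*) ≤ |C|·Δ·exp(−Δ/λ). -/
theorem gibbs_numerator_bound
    {α : Type*} [Fintype α] [DecidableEq α] [Nonempty α] (f : α → ℝ)
    (C : Finset α) (hC : C.Nonempty)
    (fstar : ℝ) (hfstar : fstar = C.inf' hC f)
    (Pstar : Finset α) (hPstar : Pstar = C.filter fun π => f π = fstar)
    (hCP : (C \ Pstar).Nonempty)
    (Δ : ℝ) (hΔ : Δ = (C \ Pstar).inf' hCP fun π => f π - fstar)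
    (lam : ℝ) (hlam0 : 0 < lam) (hlamΔ : lam ≤ Δ) :
    ∑ π ∈ C \ Pstar, Real.exp (-(f π - fstar) / lam) * (f π - fstar)
      ≤ (C.card : ℝ) * Δ * Real.exp (-Δ / lam) := by
  have hΔ0 : 0 < Δ := lt_of_lt_of_le hlam0 hlamΔ
  have key : ∀ π ∈ C \ Pstar, Real.exp (-(f π - fstar) / lam) * (f π - fstar)
      ≤ Δ * Real.exp (-Δ / lam) := by
    intro π hπ
    have hx : Δ ≤ f π - fstar := by
      rw [hΔ]
      exact Finset.inf'_le (fun π => f π - fstar) hπ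
    generalize f π - fstar = x at hx
    have h1 : (x - Δ) / lam + 1 ≤ Real.exp ((x - Δ) / lam) := Real.add_one_le_exp _
    have h2 : x - Δ ≤ Δ * ((x - Δ) / lam) := by
      rw [← mul_div_assoc, le_div_iff₀ hlam0, mul_comm Δ]
      exact mul_le_mul_of_nonneg_left hlamΔ (by linarith)
    have h3 : x ≤ Δ * Real.exp ((x - Δ) / lam) := by
      have := mul_le_mul_of_nonneg_left h1 hΔ0.le
      linarith
    calc Real.exp (-x / lam) * x
        ≤ Real.exp (-x / lam) * (Δ * Real.exp ((x - Δ) / lam)) :=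
          mul_le_mul_of_nonneg_left h3 (Real.exp_pos _).le
      _ = Δ * (Real.exp (-x / lam) * Real.exp ((x - Δ) / lam)) := by ring
      _ = Δ * Real.exp (-Δ / lam) := by
          rw [← Real.exp_add]
          congr 2
          ring
  have hcard : ((C \ Pstar).card : ℝ) ≤ C.card := by
    exact_mod_cast Finset.card_le_card Finset.sdiff_subset
  calc ∑ π ∈ C \ Pstar, Real.exp (-(f π - fstar) / lam) * (f π - fstar)
      ≤ (C \ Pstar).card • (Δ * Real.exp (-Δ / lam)) := Finset.sum_le_card_nsmul _ _ _ key
    _ = ((C \ Pstar).card : ℝ) * (Δ * Real.exp (-Δ / lam)) := by rw [nsmul_eq_mul]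
    _ ≤ (C.card : ℝ) * (Δ * Real.exp (-Δ / lam)) :=
        mul_le_mul_of_nonneg_right hcard (by positivity)
    _ = (C.card : ℝ) * Δ * Real.exp (-Δ / lam) := by ring
end

section
/- Expected suboptimality bound for the constrained Gibbs distribution: if C \ Π* is nonempty and 0 < λ ≤ Δ, then Σ_{π ∈ C} q_λ(π)·(f(π) − f*) ≤ |C|·Δ·exp(−Δ/λ)/|Π*|. -/
open Finset

/-- Expected suboptimality bound for the constrained Gibbs distribution:
if C \ Π* is nonempty and 0 < λ ≤ Δ, then
Σ_{π ∈ C} q_λ(π)(f(π) − f*) ≤ |C|·Δ·exp(−Δ/λ)/|Π*|. -/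
theorem gibbs_expected_suboptimality_bound
    {α : Type*} [Fintype α] [DecidableEq α] [Nonempty α] (f : α → ℝ)
    (C : Finset α) (hC : C.Nonempty)
    (fstar : ℝ) (hfstar : fstar = C.inf' hC f)
    (Pstar : Finset α) (hPstar : Pstar = C.filter fun π => f π = fstar)
    (hCP : (C \ Pstar).Nonempty)
    (Δ : ℝ) (hΔ : Δ = (C \ Pstar).inf' hCP fun π => f π - fstar)
    (lam : ℝ) (hlam0 : 0 < lam) (hlamΔ : lam ≤ Δ)
    (Z : ℝ) (hZ : Z = ∑ π ∈ C, Real.exp (-(f π - fstar) / lam))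
    (q : α → ℝ)
    (hq : ∀ π, q π = if π ∈ C then Real.exp (-(f π - fstar) / lam) / Z else 0) :
    ∑ π ∈ C, q π * (f π - fstar)
      ≤ (C.card : ℝ) * Δ * Real.exp (-Δ / lam) / (Pstar.card : ℝ) := by
  have hΔ0 : 0 < Δ := lt_of_lt_of_le hlam0 hlamΔ
  have hP : 0 < (Pstar.card : ℝ) := by
    obtain ⟨x, hx, hxe⟩ := Finset.exists_mem_eq_inf' hC f
    have : x ∈ Pstar := by
      rw [hPstar, Finset.mem_filter]
      exact ⟨hx, by rw [hfstar, hxe]⟩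
    exact_mod_cast Finset.card_pos.mpr ⟨x, this⟩
  have hsub : Pstar ⊆ C := by
    rw [hPstar]
    exact Finset.filter_subset _ _
  have hPZ : (Pstar.card : ℝ) ≤ Z := by
    have h1 : ∑ π ∈ Pstar, Real.exp (-(f π - fstar) / lam) = (Pstar.card : ℝ) := by
      rw [Finset.sum_congr rfl (g := fun _ => (1 : ℝ))]
      · simp
      · intro x hx
        rw [hPstar, Finset.mem_filter] at hx
        simp [hx.2]
    rw [← h1, hZ]
    exact Finset.sum_le_sum_of_subset_of_nonneg hsub (fun _ _ _ => (Real.exp_pos _).le)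
  have hterm : ∀ π ∈ C, q π * (f π - fstar) ≤ Δ * Real.exp (-Δ / lam) / (Pstar.card : ℝ) := by
    intro π hπ
    rw [hq, if_pos hπ]
    by_cases hp : π ∈ Pstar
    · rw [hPstar, Finset.mem_filter] at hp
      rw [hp.2, sub_self, mul_zero]
      positivity
    · have hx : Δ ≤ f π - fstar := by
        rw [hΔ]
        exact Finset.inf'_le (fun π => f π - fstar) (Finset.mem_sdiff.mpr ⟨hπ, hp⟩)
      generalize f π - fstar = x at hx
      have key : x * Real.exp (-x / lam) ≤ Δ * Real.exp (-Δ / lam) := by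
        have h1 : x / Δ ≤ Real.exp ((x - Δ) / lam) := by
          have h2 := Real.add_one_le_exp ((x - Δ) / lam)
          have h3 : (x - Δ) / Δ ≤ (x - Δ) / lam :=
            div_le_div_of_nonneg_left (by linarith) hlam0 hlamΔ
          have h4 : (x - Δ) / Δ = x / Δ - 1 := by field_simp
          linarith
        rw [div_le_iff₀ hΔ0] at h1
        have h5 : Real.exp (-Δ / lam) = Real.exp ((x - Δ) / lam) * Real.exp (-x / lam) := by
          rw [← Real.exp_add]
          congr 1
          ring
        rw [h5]
        have := mul_le_mul_of_nonneg_right h1 (Real.exp_pos (-x / lam)).le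
        linarith
      rw [div_mul_eq_mul_div, mul_comm]
      exact div_le_div₀ (by positivity) key hP hPZ
  calc _ ≤ ∑ π ∈ C, Δ * Real.exp (-Δ / lam) / (Pstar.card : ℝ) := Finset.sum_le_sum hterm
    _ = _ := by
      rw [Finset.sum_const, nsmul_eq_mul]
      ring
end

section
/- Gibbs tail bound: if C \ Π* is nonempty, then for every ε > 0 and every λ with 0 < λ ≤ Δ, Σ_{π ∈ C, f(π) ≥ f* + ε} q_λ(π) ≤ |C|·Δ·exp(−Δ/λ) / (|Π*|·max(ε, Δ)). -/
open Finset

/-- Gibbs tail bound: if C \ Π* is nonempty, then for every ε > 0 and 0 < λ ≤ Δ,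
Σ_{π ∈ C, f(π) ≥ f*+ε} q_λ(π) ≤ |C|·Δ·exp(−Δ/λ) / (|Π*|·max(ε, Δ)). -/
theorem gibbs_tail_bound
    {α : Type*} [Fintype α] [DecidableEq α] [Nonempty α] (f : α → ℝ)
    (C : Finset α) (hC : C.Nonempty)
    (fstar : ℝ) (hfstar : fstar = C.inf' hC f)
    (Pstar : Finset α) (hPstar : Pstar = C.filter fun π => f π = fstar)
    (hCP : (C \ Pstar).Nonempty)
    (Δ : ℝ) (hΔ : Δ = (C \ Pstar).inf' hCP fun π => f π - fstar)
    (lam : ℝ) (hlam0 : 0 < lam) (hlamΔ : lam ≤ Δ)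
    (Z : ℝ) (hZ : Z = ∑ π ∈ C, Real.exp (-(f π - fstar) / lam))
    (q : α → ℝ)
    (hq : ∀ π, q π = if π ∈ C then Real.exp (-(f π - fstar) / lam) / Z else 0)
    (ε : ℝ) (hε : 0 < ε) :
    ∑ π ∈ C.filter (fun π => fstar + ε ≤ f π), q π
      ≤ (C.card : ℝ) * Δ * Real.exp (-Δ / lam) / ((Pstar.card : ℝ) * max ε Δ) := by
  have hΔ0 : 0 < Δ := lt_of_lt_of_le hlam0 hlamΔ
  obtain ⟨p, hpC, hp⟩ := C.exists_mem_eq_inf' hC f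
  have hPne : Pstar.Nonempty := ⟨p, by
    rw [hPstar, Finset.mem_filter]
    exact ⟨hpC, by rw [hfstar, hp]⟩⟩
  have hPpos : (0 : ℝ) < Pstar.card := by exact_mod_cast hPne.card_pos
  have hPC : Pstar ⊆ C := by rw [hPstar]; exact Finset.filter_subset _ _
  have hZP : (Pstar.card : ℝ) ≤ Z := by
    have h1 : ∑ π ∈ Pstar, Real.exp (-(f π - fstar) / lam) = Pstar.card := by
      rw [Finset.sum_congr rfl (g := fun _ => (1 : ℝ))]
      · simp
      · intro x hx
        rw [hPstar, Finset.mem_filter] at hx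
        simp [hx.2]
    rw [hZ, ← h1]
    exact Finset.sum_le_sum_of_subset_of_nonneg hPC (fun _ _ _ => (Real.exp_pos _).le)
  have hM0 : 0 < max ε Δ := lt_max_of_lt_left hε
  have hkey : Real.exp (-(max ε Δ) / lam) * max ε Δ ≤ Δ * Real.exp (-Δ / lam) := by
    generalize hM : max ε Δ = M at *
    have hMΔ : Δ ≤ M := hM ▸ le_max_right _ _
    have h1 : (M - Δ) / Δ ≤ (M - Δ) / lam :=
      div_le_div_of_nonneg_left (by linarith) hlam0 hlamΔ
    have h2 := Real.add_one_le_exp ((M - Δ) / lam)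
    have h3 : M = Δ * ((M - Δ) / Δ + 1) := by field_simp; ring
    have h4 : M ≤ Δ * Real.exp ((M - Δ) / lam) := by
      calc M = Δ * ((M - Δ) / Δ + 1) := h3
        _ ≤ _ := mul_le_mul_of_nonneg_left (by linarith) hΔ0.le
    calc Real.exp (-M / lam) * M
        ≤ Real.exp (-M / lam) * (Δ * Real.exp ((M - Δ) / lam)) :=
          mul_le_mul_of_nonneg_left h4 (Real.exp_pos _).le
      _ = Δ * (Real.exp (-M / lam) * Real.exp ((M - Δ) / lam)) := by ring
      _ = Δ * Real.exp (-Δ / lam) := by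
          rw [← Real.exp_add]; congr 2; ring
  have hterm : ∀ π ∈ C.filter (fun π => fstar + ε ≤ f π),
      q π ≤ Δ * Real.exp (-Δ / lam) / ((Pstar.card : ℝ) * max ε Δ) := by
    intro π hπ
    rw [Finset.mem_filter] at hπ
    have hnot : π ∈ C \ Pstar := by
      rw [Finset.mem_sdiff]
      refine ⟨hπ.1, fun h => ?_⟩
      rw [hPstar, Finset.mem_filter] at h
      linarith [h.2, hπ.2]
    have hg : Δ ≤ f π - fstar := by
      rw [hΔ]
      exact Finset.inf'_le (fun π => f π - fstar) hnot
    have hMg : max ε Δ ≤ f π - fstar := max_le (by linarith [hπ.2]) hg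
    rw [hq, if_pos hπ.1]
    have he : Real.exp (-(f π - fstar) / lam) ≤ Real.exp (-(max ε Δ) / lam) :=
      Real.exp_le_exp.2 (div_le_div_of_nonneg_right (by linarith) hlam0.le)
    calc Real.exp (-(f π - fstar) / lam) / Z
        ≤ Real.exp (-(max ε Δ) / lam) / Pstar.card :=
          div_le_div₀ (Real.exp_pos _).le he hPpos hZP
      _ = Real.exp (-(max ε Δ) / lam) * max ε Δ / (Pstar.card * max ε Δ) := by
          rw [mul_div_mul_right _ _ hM0.ne']
      _ ≤ _ := div_le_div_of_nonneg_right hkey (by positivity)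
  have hcard : ((C.filter (fun π => fstar + ε ≤ f π)).card : ℝ) ≤ C.card := by
    exact_mod_cast Finset.card_filter_le _ _
  calc _ ≤ ((C.filter (fun π => fstar + ε ≤ f π)).card : ℝ)
        * (Δ * Real.exp (-Δ / lam) / ((Pstar.card : ℝ) * max ε Δ)) := by
        rw [← nsmul_eq_mul]; exact Finset.sum_le_card_nsmul _ _ _ hterm
    _ ≤ (C.card : ℝ) * (Δ * Real.exp (-Δ / lam) / ((Pstar.card : ℝ) * max ε Δ)) :=
        mul_le_mul_of_nonneg_right hcard (by positivity)
    _ = _ := by ring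
end

section
/- Theorem 4.3 (validity of the probabilistic model): suppose C \ Π* is nonempty and let p be any probability mass function on Π with {π : p(π) > 0} ⊆ C and KL(p‖q_λ) ≤ c/λ for some constant c ≥ 0. Then for every ε > 0 and every λ with 0 < λ ≤ Δ, Σ_{π, f(π) ≥ f* + ε} p(π) ≤ |C|·Δ·exp(−Δ/λ) / (|Π*|·max(ε, Δ)) + √(c/(2λ)). -/
open Finset

open MeasureTheory ProbabilityTheory in
lemma hoeffding_bern (b t : ℝ) (hb0 : 0 ≤ b) (hb1 : b ≤ 1) :
    1 - b + b * Real.exp t ≤ Real.exp (t * b + t ^ 2 / 8) := by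
  let μ : Measure ℝ := ENNReal.ofReal b • Measure.dirac 1 + ENNReal.ofReal (1 - b) • Measure.dirac 0
  have hintg : ∀ g : ℝ → ℝ, ∫ x, g x ∂μ = b * g 1 + (1 - b) * g 0 := by
    intro g
    have h1 : ∀ (r a : ℝ), Integrable g (ENNReal.ofReal r • Measure.dirac a) := by
      intro r a
      exact (integrable_dirac (by simp)).smul_measure (by simp)
    rw [integral_add_measure (h1 _ _) (h1 _ _), integral_smul_measure, integral_smul_measure]
    simp [ENNReal.toReal_ofReal, hb0, sub_nonneg.2 hb1]
  haveI : IsProbabilityMeasure μ := by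
    constructor
    simp only [μ, Measure.add_apply, Measure.smul_apply, measure_univ, smul_eq_mul, mul_one]
    rw [← ENNReal.ofReal_add hb0 (by linarith)]
    simp
  have hX : ∀ᵐ x ∂μ, (id x : ℝ) ∈ Set.Icc (0 : ℝ) 1 := by
    rw [ae_add_measure_iff]
    constructor <;> apply Measure.ae_smul_measure <;> simp [ae_dirac_eq]
  have h := (hasSubgaussianMGF_of_mem_Icc (μ := μ) (X := id) aemeasurable_id hX).mgf_le t
  unfold mgf at h
  rw [hintg, hintg] at h
  simp at h
  have h2 := mul_le_mul_of_nonneg_left h (Real.exp_pos (t * b)).le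
  rw [← Real.exp_add] at h2
  have e1 : Real.exp (t * b) * (b * Real.exp (t * (1 - b)) + (1 - b) * Real.exp (-(t * b)))
      = 1 - b + b * Real.exp t := by
    have a1 : Real.exp (t * b) * Real.exp (t * (1 - b)) = Real.exp t := by
      rw [← Real.exp_add]; ring_nf
    have a2 : Real.exp (t * b) * Real.exp (-(t * b)) = 1 := by
      rw [← Real.exp_add]; simp
    linear_combination b * a1 + (1 - b) * a2
  rw [e1] at h2
  refine h2.trans (le_of_eq ?_)
  congr 1
  ring

lemma pinsker_event {α : Type*} [Fintype α] [DecidableEq α] (p q : α → ℝ)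
    (hp0 : ∀ x, 0 ≤ p x) (hp1 : ∑ x, p x = 1) (hq0 : ∀ x, 0 ≤ q x) (hq1 : ∑ x, q x = 1)
    (hpq : ∀ x, 0 < p x → 0 < q x) (A : Finset α) :
    2 * (∑ x ∈ A, p x - ∑ x ∈ A, q x) ^ 2 ≤
      ∑ x ∈ Finset.univ.filter (fun x => 0 < p x), p x * Real.log (p x / q x) := by
  set a := ∑ x ∈ A, p x with ha
  set b := ∑ x ∈ A, q x with hb
  have hb0 : 0 ≤ b := Finset.sum_nonneg fun x _ => hq0 x
  have hb1 : b ≤ 1 := hq1 ▸ Finset.sum_le_univ_sum_of_nonneg hq0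
  set t := 4 * (a - b) with ht
  set L := t * b + t ^ 2 / 8 with hL
  have hH := hoeffding_bern b t hb0 hb1
  have hS : ∑ x, q x * Real.exp (if x ∈ A then t else 0) = 1 - b + b * Real.exp t := by
    have : ∀ x, q x * Real.exp (if x ∈ A then t else 0)
        = q x + (if x ∈ A then q x else 0) * (Real.exp t - 1) := by
      intro x; split_ifs
      · ring
      · simp
    simp_rw [this]
    rw [Finset.sum_add_distrib, ← Finset.sum_mul, hq1, Finset.sum_ite_mem, Finset.univ_inter, ← hb]
    ring
  have key : ∀ x, p x * (if x ∈ A then t else 0) - p x * L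
      - (if 0 < p x then p x * Real.log (p x / q x) else 0)
      ≤ q x * Real.exp (if x ∈ A then t else 0) * Real.exp (-L) - p x := by
    intro x
    set g : ℝ := if x ∈ A then t else 0
    by_cases h : 0 < p x
    · rw [if_pos h]
      have hq := hpq x h
      have h1 := Real.log_le_sub_one_of_pos
        (x := q x * Real.exp g * Real.exp (-L) / p x) (by positivity)
      rw [Real.log_div (by positivity) h.ne', Real.log_mul (by positivity) (by positivity),
        Real.log_mul (by positivity) (by positivity), Real.log_exp, Real.log_exp] at h1
      rw [Real.log_div h.ne' hq.ne']
      have h2 := mul_le_mul_of_nonneg_left h1 h.le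
      have h3 : p x * (q x * Real.exp g * Real.exp (-L) / p x - 1)
          = q x * Real.exp g * Real.exp (-L) - p x := by field_simp
      rw [h3] at h2
      linarith
    · have h0 : p x = 0 := le_antisymm (not_lt.1 h) (hp0 x)
      have := hq0 x
      simp [h0]
      positivity
  have hsum := Finset.sum_le_sum fun x (_ : x ∈ Finset.univ) => key x
  rw [Finset.sum_sub_distrib, Finset.sum_sub_distrib, Finset.sum_sub_distrib, ← Finset.sum_mul,
    ← Finset.sum_mul, hp1, hS, ← Finset.sum_filter] at hsum
  have e1 : ∑ x, p x * (if x ∈ A then t else 0) = a * t := by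
    simp_rw [mul_ite, mul_zero]
    rw [Finset.sum_ite_mem, Finset.univ_inter, ← Finset.sum_mul]
  have e2 : (1 - b + b * Real.exp t) * Real.exp (-L) ≤ 1 := by
    calc _ ≤ Real.exp L * Real.exp (-L) := by gcongr
      _ = 1 := by rw [← Real.exp_add]; simp
  rw [e1] at hsum
  have e3 : a * t - L = 2 * (a - b) ^ 2 := by rw [hL, ht]; ring
  linarith

theorem probabilistic_model_validity
    {α : Type*} [Fintype α] [DecidableEq α] [Nonempty α] (f : α → ℝ)
    (C : Finset α) (hC : C.Nonempty)
    (fstar : ℝ) (hfstar : fstar = C.inf' hC f)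
    (Pstar : Finset α) (hPstar : Pstar = C.filter fun π => f π = fstar)
    (hCP : (C \ Pstar).Nonempty)
    (Δ : ℝ) (hΔ : Δ = (C \ Pstar).inf' hCP fun π => f π - fstar)
    (lam : ℝ) (hlam0 : 0 < lam) (hlamΔ : lam ≤ Δ)
    (Z : ℝ) (hZ : Z = ∑ π ∈ C, Real.exp (-(f π - fstar) / lam))
    (q : α → ℝ)
    (hq : ∀ π, q π = if π ∈ C then Real.exp (-(f π - fstar) / lam) / Z else 0)
    (p : α → ℝ) (hp0 : ∀ π, 0 ≤ p π) (hp1 : ∑ π, p π = 1)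
    (hsupp : ∀ π, 0 < p π → π ∈ C)
    (c : ℝ) (hc : 0 ≤ c)
    (hKL : ∑ π ∈ Finset.univ.filter (fun π => 0 < p π), p π * Real.log (p π / q π)
      ≤ c / lam)
    (ε : ℝ) (hε : 0 < ε) :
    ∑ π ∈ Finset.univ.filter (fun π => fstar + ε ≤ f π), p π
      ≤ (C.card : ℝ) * Δ * Real.exp (-Δ / lam) / ((Pstar.card : ℝ) * max ε Δ)
        + Real.sqrt (c / (2 * lam)) := by
  have hΔ0 : 0 < Δ := hlam0.trans_le hlamΔ
  have hZ0 : 0 < Z := hZ ▸ Finset.sum_pos (fun _ _ => Real.exp_pos _) hC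
  have hPne : Pstar.Nonempty := by
    obtain ⟨x, hx, hfx⟩ := Finset.exists_mem_eq_inf' hC f
    exact ⟨x, by rw [hPstar, Finset.mem_filter]; exact ⟨hx, by rw [hfstar, hfx]⟩⟩
  have hcard : (0 : ℝ) < Pstar.card := by exact_mod_cast hPne.card_pos
  have hZP : (Pstar.card : ℝ) ≤ Z := by
    have : (Pstar.card : ℝ) = ∑ π ∈ Pstar, Real.exp (-(f π - fstar) / lam) := by
      rw [Finset.sum_congr rfl (g := fun _ => (1 : ℝ))]
      · simp
      · intro x hx
        rw [hPstar, Finset.mem_filter] at hx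
        simp [hx.2]
    rw [this, hZ]
    apply Finset.sum_le_sum_of_subset_of_nonneg
    · rw [hPstar]; exact Finset.filter_subset _ _
    · intros; positivity
  have hq0 : ∀ x, 0 ≤ q x := by
    intro x; rw [hq]; split_ifs <;> positivity
  have hq1 : ∑ x, q x = 1 := by
    simp_rw [hq]
    rw [Finset.sum_ite_mem, Finset.univ_inter, ← Finset.sum_div, ← hZ, div_self hZ0.ne']
  have hpq : ∀ x, 0 < p x → 0 < q x := by
    intro x hx; rw [hq, if_pos (hsupp x hx)]; positivity
  set A := Finset.univ.filter (fun π => fstar + ε ≤ f π) with hA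
  have hP := (pinsker_event p q hp0 hp1 hq0 hq1 hpq A).trans hKL
  have h1 : ∑ x ∈ A, p x - ∑ x ∈ A, q x ≤ Real.sqrt (c / (2 * lam)) := by
    apply Real.le_sqrt_of_sq_le
    have : c / (2 * lam) = c / lam / 2 := by field_simp
    rw [this]; linarith
  set m := max ε Δ with hm
  have hmΔ : Δ ≤ m := le_max_right _ _
  have hm0 : 0 < m := hΔ0.trans_le hmΔ
  have hexp : Real.exp (-m / lam) ≤ Δ * Real.exp (-Δ / lam) / m := by
    rw [le_div_iff₀ hm0]
    have a1 : m / Δ ≤ Real.exp ((m - Δ) / lam) := by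
      have a2 := Real.add_one_le_exp ((m - Δ) / Δ)
      have a3 : (m - Δ) / Δ ≤ (m - Δ) / lam :=
        div_le_div_of_nonneg_left (by linarith) hlam0 hlamΔ
      have a4 : m / Δ = (m - Δ) / Δ + 1 := by field_simp; ring
      rw [a4]; exact a2.trans (Real.exp_le_exp.2 a3)
    rw [div_le_iff₀ hΔ0] at a1
    calc Real.exp (-m / lam) * m ≤ Real.exp (-m / lam) * (Real.exp ((m - Δ) / lam) * Δ) := by gcongr
      _ = Δ * (Real.exp (-m / lam) * Real.exp ((m - Δ) / lam)) := by ring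
      _ = _ := by rw [← Real.exp_add]; congr 2; ring
  have h2 : ∑ x ∈ A, q x ≤ (C.card : ℝ) * (Real.exp (-m / lam) / Pstar.card) := by
    simp_rw [hq]
    rw [Finset.sum_ite_mem]
    have hb : ∀ x ∈ A ∩ C, Real.exp (-(f x - fstar) / lam) / Z
        ≤ Real.exp (-m / lam) / Pstar.card := by
      intro x hx
      rw [Finset.mem_inter, hA, Finset.mem_filter] at hx
      obtain ⟨⟨_, hxε⟩, hxC⟩ := hx
      have hxm : m ≤ f x - fstar := by
        apply max_le (by linarith)
        rw [hΔ]
        apply Finset.inf'_le (fun π => f π - fstar)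
        rw [Finset.mem_sdiff, hPstar, Finset.mem_filter]
        refine ⟨hxC, fun h => ?_⟩
        linarith [h.2]
      gcongr
    refine (Finset.sum_le_card_nsmul _ _ _ hb).trans ?_
    rw [nsmul_eq_mul]
    gcongr
    exact Finset.inter_subset_right
  have h3 : (C.card : ℝ) * (Real.exp (-m / lam) / Pstar.card)
      ≤ (C.card : ℝ) * Δ * Real.exp (-Δ / lam) / ((Pstar.card : ℝ) * m) := by
    calc _ ≤ (C.card : ℝ) * ((Δ * Real.exp (-Δ / lam) / m) / Pstar.card) := by gcongr
      _ = _ := by field_simp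
  linarith
end

section
/- Entropy-regularized policy gradient identity: let E be a real normed vector space, Π a finite type, and p : E → Π → ℝ such that, for every θ in some neighborhood of θ₀, Σ_π p(θ)(π) = 1, and for every π the map θ ↦ p(θ)(π) is differentiable at θ₀ with p(θ₀)(π) > 0. Then for every Ψ : Π → ℝ, every λ ∈ ℝ and every baseline b ∈ ℝ, the Fréchet derivative at θ₀ of θ ↦ Σ_π p(θ)(π)·(Ψ(π) + λ·log p(θ)(π)) equals Σ_π p(θ₀)(π)·(Ψ(π) − b + λ·log p(θ₀)(π)) times the Fréchet derivative at θ₀ of θ ↦ log p(θ)(π). -/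
open Finset

/-- Entropy-regularized policy gradient identity. -/
theorem entropy_regularized_policy_gradient
    {E : Type*} [NormedAddCommGroup E] [NormedSpace ℝ E]
    {α : Type*} [Fintype α] (p : E → α → ℝ) (θ₀ : E)
    (hsum : ∀ᶠ θ in nhds θ₀, ∑ π, p θ π = 1)
    (hdiff : ∀ π, DifferentiableAt ℝ (fun θ => p θ π) θ₀)
    (hpos : ∀ π, 0 < p θ₀ π)
    (Ψ : α → ℝ) (lam : ℝ) (b : ℝ) :
    fderiv ℝ (fun θ => ∑ π, p θ π * (Ψ π + lam * Real.log (p θ π))) θ₀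
      = ∑ π, (p θ₀ π * (Ψ π - b + lam * Real.log (p θ₀ π))) •
          fderiv ℝ (fun θ => Real.log (p θ π)) θ₀ := by
  have h1 : ∀ π, HasFDerivAt (fun θ => p θ π) (fderiv ℝ (fun θ => p θ π) θ₀) θ₀ :=
    fun π => (hdiff π).hasFDerivAt
  have hlog : ∀ π, HasFDerivAt (fun θ => Real.log (p θ π))
      ((p θ₀ π)⁻¹ • fderiv ℝ (fun θ => p θ π) θ₀) θ₀ :=
    fun π => (h1 π).log (hpos π).ne'
  have hzero : ∑ π, fderiv ℝ (fun θ => p θ π) θ₀ = 0 := by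
    have hs : HasFDerivAt (fun θ => ∑ π, p θ π) (∑ π, fderiv ℝ (fun θ => p θ π) θ₀) θ₀ :=
      HasFDerivAt.fun_sum fun π _ => h1 π
    have hc : HasFDerivAt (fun θ => ∑ π, p θ π) (0 : E →L[ℝ] ℝ) θ₀ :=
      (hasFDerivAt_const (1 : ℝ) θ₀).congr_of_eventuallyEq hsum
    exact hs.unique hc
  have hmain : HasFDerivAt (fun θ => ∑ π, p θ π * (Ψ π + lam * Real.log (p θ π)))
      (∑ π, (p θ₀ π • (lam • ((p θ₀ π)⁻¹ • fderiv ℝ (fun θ => p θ π) θ₀))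
        + (Ψ π + lam * Real.log (p θ₀ π)) • fderiv ℝ (fun θ => p θ π) θ₀)) θ₀ :=
    HasFDerivAt.fun_sum fun π _ => (h1 π).mul (((hlog π).const_mul lam).const_add (Ψ π))
  rw [hmain.fderiv]
  have hz : ∑ π, (lam + b) • fderiv ℝ (fun θ => p θ π) θ₀ = 0 := by
    rw [← Finset.smul_sum, hzero, smul_zero]
  rw [← sub_eq_zero, ← Finset.sum_sub_distrib, ← hz]
  refine Finset.sum_congr rfl fun π _ => ?_
  rw [(hlog π).fderiv]
  have hne := (hpos π).ne'
  simp only [smul_smul, ← add_smul, ← sub_smul]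
  congr 1
  field_simp
  ring
end

section
/- TSPDL feasibility criterion (Proposition 5.1, unit demands): let n be a natural number and D : Fin n → ℝ a function of draft limits, where each of the n ports has unit demand so that the cumulative load after the k-th visited port is k + 1. Call a permutation σ of Fin n feasible if (k + 1 : ℝ) ≤ D(σ(k)) for every k ∈ Fin n. Then there exists a feasible permutation of Fin n if and only if every permutation σ₀ of Fin n for which D ∘ σ₀ is monotone non-decreasing (i.e., σ₀ orders the ports in ascending order of draft limits) is feasible. -/
/-- TSPDL feasibility criterion with unit demands: a feasible visiting order exists iff
every permutation ordering the ports in ascending order of draft limits is feasible. -/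
theorem tspdl_feasibility_unit_demands (n : ℕ) (D : Fin n → ℝ) :
    (∃ σ : Equiv.Perm (Fin n), ∀ k : Fin n, ((k : ℕ) + 1 : ℝ) ≤ D (σ k)) ↔
    (∀ σ₀ : Equiv.Perm (Fin n), Monotone (D ∘ σ₀) →
      ∀ k : Fin n, ((k : ℕ) + 1 : ℝ) ≤ D (σ₀ k)) := by
  constructor
  · rintro ⟨σ, hσ⟩ σ₀ hm k
    obtain ⟨j, hj, hkj⟩ : ∃ j ≤ k, k ≤ σ.symm (σ₀ j) := by
      by_contra! h
      have hc : (Finset.Iic k).card ≤ (Finset.Iio k).card := by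
        apply Finset.card_le_card_of_injOn (fun j => σ.symm (σ₀ j))
        · intro j hj
          simpa using h j (by simpa using hj)
        · intro a _ b _ hab
          simpa using hab
      rw [Fin.card_Iic, Fin.card_Iio] at hc
      omega
    have h1 := hσ (σ.symm (σ₀ j))
    rw [Equiv.apply_symm_apply] at h1
    have h2 : D (σ₀ j) ≤ D (σ₀ k) := hm hj
    have h3 : ((k : ℕ) : ℝ) ≤ ((σ.symm (σ₀ j) : Fin n) : ℕ) := by
      exact_mod_cast hkj
    linarith
  · intro h
    exact ⟨Tuple.sort D, h _ (Tuple.monotone_sort D)⟩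
end

section
/- TSPDL feasibility criterion with general demands: let n be a natural number, D : Fin n → ℝ a function of draft limits, and q : Fin n → ℝ a function of nonnegative demands. Call a permutation σ of Fin n feasible if for every k ∈ Fin n the cumulative load Σ_{j ≤ k} q(σ(j)) is at most D(σ(k)). Then there exists a feasible permutation of Fin n if and only if every permutation σ₀ of Fin n for which D ∘ σ₀ is monotone non-decreasing is feasible. -/
open Finset

/-- TSPDL feasibility criterion with general nonnegative demands: a feasible visiting
order exists iff every permutation ordering the ports in ascending order of draft
limits is feasible. -/
theorem tspdl_feasibility_general_demands (n : ℕ) (D : Fin n → ℝ) (q : Fin n → ℝ)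
    (hq : ∀ i, 0 ≤ q i) :
    (∃ σ : Equiv.Perm (Fin n),
      ∀ k : Fin n, ∑ j ∈ Finset.Iic k, q (σ j) ≤ D (σ k)) ↔
    (∀ σ₀ : Equiv.Perm (Fin n), Monotone (D ∘ σ₀) →
      ∀ k : Fin n, ∑ j ∈ Finset.Iic k, q (σ₀ j) ≤ D (σ₀ k)) := by
  constructor
  · rintro ⟨σ, hσ⟩ σ₀ hmono k
    obtain ⟨m, hm, hmax⟩ := Finset.exists_max_image (Finset.Iic k)
      (fun j => σ.symm (σ₀ j)) ⟨k, Finset.mem_Iic.mpr le_rfl⟩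
    have h1 : ∑ j ∈ Finset.Iic k, q (σ₀ j)
        = ∑ i ∈ (Finset.Iic k).map (σ₀.trans σ.symm).toEmbedding, q (σ i) := by
      rw [Finset.sum_map]
      simp
    have h2 : (Finset.Iic k).map (σ₀.trans σ.symm).toEmbedding
        ⊆ Finset.Iic (σ.symm (σ₀ m)) := by
      intro i hi
      obtain ⟨j, hj, rfl⟩ := Finset.mem_map.mp hi
      exact Finset.mem_Iic.mpr (hmax j hj)
    have h3 := Finset.sum_le_sum_of_subset_of_nonneg (f := fun i => q (σ i)) h2
      (fun i _ _ => hq (σ i))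
    have h4 := hσ (σ.symm (σ₀ m))
    rw [Equiv.apply_symm_apply] at h4
    have h5 : D (σ₀ m) ≤ D (σ₀ k) := hmono (Finset.mem_Iic.mp hm)
    rw [h1]
    exact h3.trans (h4.trans h5)
  · intro h
    exact ⟨Tuple.sort D, h _ (Tuple.monotone_sort D)⟩
end
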